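/- KT(Δ⁰₂) is not contained in LK(Δ⁰₂): there exists a real A with A ∈ KT(Δ⁰₂) and A ∉ LK(Δ⁰₂). -/

import Mathlib

/-! Common framework: prefix-free Kolmogorov complexity via a universal
prefix-free oracle machine, Δ⁰₂ functions and orders, Turing and wtt
reducibility, Ω, and the uniform measure on Cantor space. -/

/-- Finite binary strings, `2^{<ω}`. -/
abbrev BinStr := List Bool

/-- Reals, i.e. infinite binary sequences `2^ω`. -/
abbrev Seq2 := ℕ → Bool

/-- The initial segment `A↾n` of a real `A ∈ 2^ω`. -/
def restrict (A : Seq2) (n : ℕ) : BinStr := (List.range n).map A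

/-- A prefix-free oracle machine, presented as a computable enumeration of
axioms `(τ, p, y)`, meaning: on any oracle extending `τ`, the machine halts on
program `p` with output `y`.  Consistency says that for compatible oracle
strings the halting programs form a prefix-free set and outputs are unique. -/
structure PrefixOracleMachine where
  axioms : ℕ → Option (BinStr × BinStr × BinStr)
  axioms_computable : Computable axioms
  consistent : ∀ s t τ₁ p₁ y₁ τ₂ p₂ y₂,
    axioms s = some (τ₁, p₁, y₁) → axioms t = some (τ₂, p₂, y₂) →
    (τ₁ <+: τ₂ ∨ τ₂ <+: τ₁) → p₁ <+: p₂ → p₁ = p₂ ∧ y₁ = y₂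

/-- `M.Computes A p y` : with oracle `A`, machine `M` halts on program `p` with
output `y`. -/
def PrefixOracleMachine.Computes (M : PrefixOracleMachine) (A : Seq2) (p y : BinStr) : Prop :=
  ∃ s τ, M.axioms s = some (τ, p, y) ∧ ∃ n, τ = restrict A n

/-- A universal prefix-free oracle machine: it describes every string (relative
to every oracle), and it simulates every prefix-free oracle machine up to an
additive constant in the length of programs. -/
structure UniversalPrefixMachine extends PrefixOracleMachine where
  total : ∀ (A : Seq2) (y : BinStr), ∃ p, toPrefixOracleMachine.Computes A p y
  universal : ∀ M : PrefixOracleMachine, ∃ c : ℕ, ∀ (A : Seq2) (p y : BinStr),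
    M.Computes A p y →
      ∃ q, toPrefixOracleMachine.Computes A q y ∧ q.length ≤ p.length + c

/-- `K^A(y)` : prefix-free Kolmogorov complexity of `y` relative to oracle `A`. -/
noncomputable def KOr (U : UniversalPrefixMachine) (A : Seq2) (y : BinStr) : ℕ :=
  sInf {n | ∃ p : BinStr, p.length = n ∧ U.toPrefixOracleMachine.Computes A p y}

/-- The all-zeros (recursive) oracle. -/
def zeroSeq : Seq2 := fun _ => false

/-- `K(y)` : (unrelativized) prefix-free Kolmogorov complexity. -/
noncomputable def Kc (U : UniversalPrefixMachine) (y : BinStr) : ℕ := KOr U zeroSeq y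

/-- `K(n)` : the complexity of the string of `n` zeros. -/
noncomputable def KcNat (U : UniversalPrefixMachine) (n : ℕ) : ℕ :=
  Kc U (List.replicate n false)

/-- `A ∈ KT(g)` : `A` is K-trivial up to `g`. -/
def KT (U : UniversalPrefixMachine) (g : ℕ → ℕ) (A : Seq2) : Prop :=
  ∃ c : ℕ, ∀ n : ℕ, Kc U (restrict A n) ≤ KcNat U n + g n + c

/-- `A ∈ LK(f)` : `A` is low for K up to `f`. -/
def LK (U : UniversalPrefixMachine) (f : BinStr → ℕ) (A : Seq2) : Prop :=
  ∃ c : ℕ, ∀ σ : BinStr, Kc U σ ≤ KOr U A σ + f σ + c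

/-- The position of a string in the length-lexicographic ordering of `2^{<ω}`. -/
def strNum (σ : BinStr) : ℕ := σ.foldl (fun n b => 2 * n + (if b then 2 else 1)) 0

/-- A function `ℕ → ℕ` is Δ⁰₂ iff it has a recursive approximation. -/
def Delta02Fun (g : ℕ → ℕ) : Prop :=
  ∃ G : ℕ → ℕ → ℕ, Computable₂ G ∧ ∀ x, ∃ t, ∀ s ≥ t, G s x = g x

/-- A function `2^{<ω} → ℕ` is Δ⁰₂ iff it has a recursive approximation. -/
def Delta02StrFun (f : BinStr → ℕ) : Prop :=
  ∃ F : ℕ → BinStr → ℕ, Computable₂ F ∧ ∀ σ, ∃ t, ∀ s ≥ t, F s σ = f σ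

/-- A real is Δ⁰₂ iff it has a recursive approximation. -/
def Delta02Seq (A : Seq2) : Prop :=
  ∃ F : ℕ → ℕ → Bool, Computable₂ F ∧ ∀ x, ∃ t, ∀ s ≥ t, F s x = A x

/-- An order: an unbounded nondecreasing function `ℕ → ℕ`. -/
def IsOrder (g : ℕ → ℕ) : Prop := Monotone g ∧ ∀ b : ℕ, ∃ m, b < g m

/-- An order on strings: unbounded and nondecreasing with respect to the
length-lexicographic ordering of `2^{<ω}`. -/
def IsStrOrder (f : BinStr → ℕ) : Prop :=
  (∀ σ τ : BinStr, strNum σ ≤ strNum τ → f σ ≤ f τ) ∧ ∀ b : ℕ, ∃ σ, b < f σ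

/-- `A ∈ KT(Δ⁰₂)` : `A` is K-trivial up to every Δ⁰₂ order. -/
def KTDelta (U : UniversalPrefixMachine) (A : Seq2) : Prop :=
  ∀ g : ℕ → ℕ, Delta02Fun g → IsOrder g → KT U g A

/-- `A ∈ LK(Δ⁰₂)` : `A` is low for K up to every Δ⁰₂ order. -/
def LKDelta (U : UniversalPrefixMachine) (A : Seq2) : Prop :=
  ∀ f : BinStr → ℕ, Delta02StrFun f → IsStrOrder f → LK U f A

/-- A Δ⁰₂ function is finite-to-one approximable if it has a recursive
approximation `F` such that for every `n`, for all but finitely many `m`,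
`F s m > n` for all stages `s`. -/
def FinToOneApprox (f : ℕ → ℕ) : Prop :=
  ∃ F : ℕ → ℕ → ℕ, Computable₂ F ∧ (∀ x, ∃ t, ∀ s ≥ t, F s x = f x) ∧
    ∀ n : ℕ, {m : ℕ | ∃ s, F s m ≤ n}.Finite

/-- A Turing functional, presented as a computable enumeration of axioms
`(τ, n, b)`, meaning: on any oracle extending `τ`, the output bit `n` is `b`. -/
structure TuringFunctional where
  axioms : ℕ → Option (BinStr × ℕ × Bool)
  axioms_computable : Computable axioms
  consistent : ∀ s t τ₁ n₁ b₁ τ₂ n₂ b₂,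
    axioms s = some (τ₁, n₁, b₁) → axioms t = some (τ₂, n₂, b₂) →
    (τ₁ <+: τ₂ ∨ τ₂ <+: τ₁) → n₁ = n₂ → b₁ = b₂

/-- `Φ.Computes B A` : `Φ^B = A`. -/
def TuringFunctional.Computes (Φ : TuringFunctional) (B A : Seq2) : Prop :=
  ∀ n : ℕ, ∃ s k, Φ.axioms s = some (restrict B k, n, A n)

/-- Turing reducibility `A ≤_T B`. -/
def TuringLE (A B : Seq2) : Prop := ∃ Φ : TuringFunctional, Φ.Computes B A

/-- Weak truth-table reducibility `A ≤_wtt B` : a Turing reduction whose use is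
bounded by a recursive function. -/
def WttLE (A B : Seq2) : Prop :=
  ∃ (Φ : TuringFunctional) (u : ℕ → ℕ), Computable u ∧
    ∀ n : ℕ, ∃ s k, k ≤ u n ∧ Φ.axioms s = some (restrict B k, n, A n)

/-- The effective join `A ⊕ B`. -/
def join (A B : Seq2) : Seq2 := fun n => if n % 2 = 0 then A (n / 2) else B (n / 2)

/-- `A` is Martin-Löf random: `K(A↾n) ≥ n - c` for all `n`. -/
def MLRandom (U : UniversalPrefixMachine) (A : Seq2) : Prop :=
  ∃ c : ℕ, ∀ n : ℕ, n ≤ Kc U (restrict A n) + c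

/-- `A` is infinitely often K-trivial. -/
def InfOftenKTrivial (U : UniversalPrefixMachine) (A : Seq2) : Prop :=
  ∃ c : ℕ, {n : ℕ | Kc U (restrict A n) ≤ KcNat U n + c}.Infinite

/-- K-reducibility `B ≤_K A`. -/
def KLE (U : UniversalPrefixMachine) (B A : Seq2) : Prop :=
  ∃ c : ℕ, ∀ n : ℕ, Kc U (restrict B n) ≤ Kc U (restrict A n) + c

/-- LK-reducibility `A ≤_LK B`. -/
def LKLE (U : UniversalPrefixMachine) (A B : Seq2) : Prop :=
  ∃ c : ℕ, ∀ σ : BinStr, KOr U B σ ≤ KOr U A σ + c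

/-- `A` is weakly low for K: `K(σ) ≤ K^A(σ) + c` for infinitely many strings σ. -/
def WeaklyLowForK (U : UniversalPrefixMachine) (A : Seq2) : Prop :=
  ∃ c : ℕ, {σ : BinStr | Kc U σ ≤ KOr U A σ + c}.Infinite

/-- Chaitin's Ω : the measure of the domain of the universal machine. -/
noncomputable def Omega (U : UniversalPrefixMachine) : ℝ :=
  ∑' p : {p : BinStr // ∃ y, U.toPrefixOracleMachine.Computes zeroSeq p y},
    ((2 : ℝ) ^ (p : BinStr).length)⁻¹

/-- The `n`-th binary digit of a real number `x`. -/
noncomputable def realBit (x : ℝ) (n : ℕ) : Bool :=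
  decide (⌊x * 2 ^ (n + 1)⌋ % 2 = 1)

/-- `Ω↾n` : the length-`n` initial segment of the binary expansion of Ω. -/
noncomputable def omegaStr (U : UniversalPrefixMachine) (n : ℕ) : BinStr :=
  (List.range n).map (realBit (Omega U))

/-- `A` is low for Ω. -/
def LowForOmega (U : UniversalPrefixMachine) (A : Seq2) : Prop :=
  ∀ c : ℕ, ∃ n : ℕ, KOr U A (omegaStr U n) + c < n

/-- The uniform (coin-flipping) measure on `2^ω`, obtained as the image of
Lebesgue measure on `[0,1]` under the binary-expansion map. -/
noncomputable def cantorMeasure : MeasureTheory.Measure Seq2 :=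
  MeasureTheory.Measure.map (fun x : ℝ => fun n : ℕ => realBit x n)
    (MeasureTheory.volume.restrict (Set.Icc (0 : ℝ) 1))

/-! ### Computability of auxiliary functions -/

/-- The last stage `≤ s` at which the sequence `F` changed its value. -/
def lastChange (F : ℕ → ℕ) (s : ℕ) : ℕ :=
  Nat.rec 0 (fun s r => bif F (s + 1) == F s then r else s + 1) s

theorem lastChange_succ (F : ℕ → ℕ) (s : ℕ) :
    lastChange F (s + 1) = if F (s + 1) = F s then lastChange F s else s + 1 := by
  show (bif F (s + 1) == F s then lastChange F s else s + 1) = _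
  by_cases h : F (s + 1) = F s
  · simp [h]
  · rw [beq_eq_false_iff_ne.2 h, if_neg h, cond_false]

theorem lastChange_stable (F : ℕ → ℕ) {s r : ℕ} (h : lastChange F s ≤ r) (hr : r ≤ s) :
    lastChange F r = lastChange F s ∧ F r = F s := by
  induction s with
  | zero => obtain rfl : r = 0 := by omega
            exact ⟨rfl, rfl⟩
  | succ s ih =>
    rcases Nat.lt_or_ge s r with h1 | h1
    · obtain rfl : r = s + 1 := by omega
      exact ⟨rfl, rfl⟩
    · rw [lastChange_succ] at h ⊢
      split_ifs at h ⊢ with h2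
      · rw [h2]; exact ih h h1
      · omega

/-- If `F` converges to `v`, then the last change of `F` happens at a stage `a` which can be
recognised from every `n ≥ a`. -/
theorem exists_lastChange {F : ℕ → ℕ} {v : ℕ} (h : ∃ t, ∀ s ≥ t, F s = v) :
    ∃ a, ∀ n ≥ a, lastChange F n = a ∧ F n = v := by
  obtain ⟨t, ht⟩ := h
  have key : ∀ s ≥ t, lastChange F s = lastChange F t := by
    intro s hs
    induction s, hs using Nat.le_induction with
    | base => rfl
    | succ s hs ih => rw [lastChange_succ, ht _ hs, ht _ (by omega), if_pos rfl, ih]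
  refine ⟨lastChange F t, fun n hn => ?_⟩
  rcases le_total n t with h1 | h1
  · obtain ⟨h2, h3⟩ := lastChange_stable F hn h1
    exact ⟨h2, h3.trans (ht t le_rfl)⟩
  · exact ⟨key n h1, ht n h1⟩

theorem Computable₂.natBeq {α : Type*} [Primcodable α] {f g : α → ℕ} (hf : Computable f)
    (hg : Computable g) : Computable fun a => (f a == g a) :=
  (Primrec.beq (α := ℕ)).to_comp.comp hf hg

theorem computable_lastChange {α : Type*} [Primcodable α] {F : α → ℕ → ℕ} (hF : Computable₂ F) :
    Computable₂ fun a s => lastChange (F a) s := by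
  have hh : Computable₂ fun (p : α × ℕ) (q : ℕ × ℕ) =>
      bif F p.1 (q.1 + 1) == F p.1 q.1 then q.2 else q.1 + 1 := by
    have h1 : Computable fun r : (α × ℕ) × (ℕ × ℕ) => r.1.1 := Computable.fst.comp Computable.fst
    have h2 : Computable fun r : (α × ℕ) × (ℕ × ℕ) => r.2.1 := Computable.fst.comp Computable.snd
    have h3 : Computable fun r : (α × ℕ) × (ℕ × ℕ) => r.2.1 + 1 := Computable.succ.comp h2
    exact Computable.cond (Computable₂.natBeq (hF.comp h1 h3) (hF.comp h1 h2))
      (Computable.snd.comp Computable.snd) h3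
  exact Computable.nat_rec Computable.snd (Computable.const 0) hh

/-- The least `j < b` satisfying `P`, or `b` if there is none. -/
def leastBelow (P : ℕ → Bool) (b : ℕ) : ℕ :=
  Nat.rec 0 (fun b r => bif r == b && !P b then b + 1 else r) b

theorem leastBelow_succ (P : ℕ → Bool) (b : ℕ) :
    leastBelow P (b + 1) = bif leastBelow P b == b && !P b then b + 1 else leastBelow P b := rfl

theorem leastBelow_eq (P : ℕ → Bool) {x b : ℕ} (hx : P x = true) (hlt : ∀ y < x, P y = false) :
    leastBelow P b = min b x := by
  induction b with
  | zero => simp [leastBelow]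
  | succ b ih =>
    rw [leastBelow_succ, ih]
    rcases Nat.lt_trichotomy b x with h | rfl | h
    · have h1 : min b x = b := by omega
      simp [h1, hlt b h]; omega
    · simp [hx]
    · have h1 : min b x = x := by omega
      have h2 : min (b + 1) x = x := by omega
      have h3 : (x == b) = false := by simp; omega
      simp [h1, h2, h3]

theorem computable_leastBelow {α : Type*} [Primcodable α] {P : α → ℕ → Bool} {b : α → ℕ}
    (hP : Computable₂ P) (hb : Computable b) : Computable fun a => leastBelow (P a) (b a) := by
  have hh : Computable₂ fun (a : α) (q : ℕ × ℕ) =>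
      bif q.2 == q.1 && !P a q.1 then q.1 + 1 else q.2 := by
    have h2 : Computable fun r : α × (ℕ × ℕ) => r.2.1 := Computable.fst.comp Computable.snd
    have h3 : Computable fun r : α × (ℕ × ℕ) => r.2.2 := Computable.snd.comp Computable.snd
    exact Computable.cond (Primrec.and.to_comp.comp (Computable₂.natBeq h3 h2)
      (Primrec.not.to_comp.comp (hP.comp Computable.fst h2))) (Computable.succ.comp h2) h3
  exact Computable.nat_rec hb (Computable.const 0) hh

theorem restrict_succ (A : Seq2) (n : ℕ) : restrict A (n + 1) = restrict A n ++ [A n] := by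
  simp [restrict, List.range_succ]

theorem length_restrict (A : Seq2) (n : ℕ) : (restrict A n).length = n := by simp [restrict]

theorem computable_restrict {α : Type*} [Primcodable α] {A : α → Seq2} {n : α → ℕ}
    (hA : Computable₂ A) (hn : Computable n) : Computable fun a => restrict (A a) (n a) := by
  have hh : Computable₂ fun (a : α) (q : ℕ × BinStr) => q.2 ++ [A a q.1] :=
    Computable.list_concat.comp (Computable.snd.comp Computable.snd)
      (hA.comp Computable.fst (Computable.fst.comp Computable.snd))
  refine (Computable.nat_rec hn (Computable.const []) hh).of_eq fun a => ?_
  induction n a with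
  | zero => rfl
  | succ n ih => rw [restrict_succ, ← ih]

/-! ### `Δ⁰₂` functions -/

theorem Delta02Fun.const (c : ℕ) : Delta02Fun fun _ => c :=
  ⟨fun _ _ => c, Computable.const c, fun _ => ⟨0, fun _ _ => rfl⟩⟩

theorem Delta02Fun.add {f g : ℕ → ℕ} (hf : Delta02Fun f) (hg : Delta02Fun g) :
    Delta02Fun fun x => f x + g x := by
  obtain ⟨F, hF, hF'⟩ := hf
  obtain ⟨G, hG, hG'⟩ := hg
  refine ⟨fun s x => F s x + G s x, Primrec.nat_add.to_comp.comp hF hG, fun x => ?_⟩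
  obtain ⟨t, ht⟩ := hF' x
  obtain ⟨u, hu⟩ := hG' x
  exact ⟨max t u, fun s hs => by simp only [ht s (by omega), hu s (by omega)]⟩

theorem Delta02Fun.sum {f : ℕ → ℕ → ℕ} (hf : ∀ j, Delta02Fun (f j)) (n : ℕ) :
    Delta02Fun fun x => ∑ j ∈ Finset.range n, f j x := by
  induction n with
  | zero => simpa using Delta02Fun.const 0
  | succ n ih => simpa only [Finset.sum_range_succ] using ih.add (hf n)

/-- The generalised inverse of an unbounded `Δ⁰₂` function is `Δ⁰₂`. -/
theorem Delta02Fun.exists_inverse {h : ℕ → ℕ} (hh : Delta02Fun h) (hub : ∀ k, ∃ x, k ≤ h x) :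
    ∃ v, Delta02Fun v ∧ ∀ k, k ≤ h (v k) ∧ ∀ x < v k, h x < k := by
  obtain ⟨H, hH, hlim⟩ := hh
  classical
  refine ⟨fun k => Nat.find (hub k), ⟨fun s k => leastBelow (fun x => decide (k ≤ H s x)) s,
    ?_, fun k => ?_⟩, fun k => ⟨Nat.find_spec (hub k), fun x hx => ?_⟩⟩
  · refine computable_leastBelow (α := ℕ × ℕ) (P := fun p x => decide (p.2 ≤ H p.1 x)) ?_
      Computable.fst
    exact (Primrec.nat_le.decide).to_comp.comp (Computable.snd.comp Computable.fst)
      (hH.comp (Computable.fst.comp Computable.fst) Computable.snd)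
  · set x₀ := Nat.find (hub k) with hx₀
    have : ∀ b, ∃ t, ∀ s ≥ t, ∀ x < b, H s x = h x := by
      intro b
      induction b with
      | zero => exact ⟨0, by simp⟩
      | succ b ih =>
        obtain ⟨t, ht⟩ := ih
        obtain ⟨u, hu⟩ := hlim b
        refine ⟨max t u, fun s hs x hx => ?_⟩
        rcases Nat.lt_succ_iff_lt_or_eq.1 hx with h1 | rfl
        · exact ht s (by omega) x h1
        · exact hu s (by omega)
    obtain ⟨t, ht⟩ := this (x₀ + 1)
    refine ⟨max t x₀, fun s hs => ?_⟩
    have h1 : k ≤ h x₀ := Nat.find_spec (hub k)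
    show leastBelow _ s = x₀
    rw [leastBelow_eq (x := x₀)]
    · omega
    · simpa [ht s (by omega) x₀ (by omega)] using h1
    · intro y hy
      have h2 : ¬ k ≤ h y := Nat.find_min (hub k) hy
      simpa [ht s (by omega) y (by omega)] using h2
  · exact not_le.1 (Nat.find_min (hub k) hx)

/-- A computable approximation of a convergent sequence has a `Δ⁰₂` modulus. -/
theorem exists_modulus {F : ℕ → ℕ → ℕ} {v : ℕ → ℕ} (hF : Computable₂ F)
    (hlim : ∀ x, ∃ t, ∀ s ≥ t, F s x = v x) :
    ∃ m, Delta02Fun m ∧ ∀ x, ∀ s ≥ m x, F s x = v x := by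
  choose a ha using fun x => exists_lastChange (F := fun s => F s x) (hlim x)
  have hF' : Computable₂ fun x s => F s x := hF.comp Computable.snd Computable.fst
  refine ⟨a, ⟨fun s x => lastChange (fun s => F s x) s, ?_, fun x => ⟨a x, fun s hs => (ha x s hs).1⟩⟩,
    fun x s hs => (ha x s hs).2⟩
  exact (computable_lastChange hF').comp Computable.snd Computable.fst

/-! ### A universal approximation scheme -/

/-- A slowed-down simulation of `s ↦ code c on (s, k)`, keeping the next stage to be
evaluated and the last value found. -/
def simStep (c k s : ℕ) (p : ℕ × ℕ) : ℕ × ℕ :=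
  ((Nat.Partrec.Code.evaln s (Denumerable.ofNat Nat.Partrec.Code c) (Nat.pair p.1 k)).map
    fun v => (p.1 + 1, v)).getD p

/-- The state of the slowed-down simulation at stage `s`. -/
def simState (c k s : ℕ) : ℕ × ℕ :=
  Nat.rec (0, 0) (fun s p => simStep c k s p) s

theorem simState_succ (c k s : ℕ) : simState c k (s + 1) = simStep c k s (simState c k s) := rfl

/-- The value approximated by index `c` at argument `k` and stage `s`, never exceeding `s`. -/
def simVal (c k s : ℕ) : ℕ := min (simState c k s).2 s

theorem computable_simStep :
    Computable fun r : ((ℕ × ℕ) × ℕ) × (ℕ × (ℕ × ℕ)) => simStep r.1.1.1 r.1.1.2 r.2.1 r.2.2 := by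
  have hc : Computable fun r : ((ℕ × ℕ) × ℕ) × (ℕ × (ℕ × ℕ)) => r.1.1.1 :=
    Computable.fst.comp (Computable.fst.comp Computable.fst)
  have hk : Computable fun r : ((ℕ × ℕ) × ℕ) × (ℕ × (ℕ × ℕ)) => r.1.1.2 :=
    Computable.snd.comp (Computable.fst.comp Computable.fst)
  have hs : Computable fun r : ((ℕ × ℕ) × ℕ) × (ℕ × (ℕ × ℕ)) => r.2.1 :=
    Computable.fst.comp Computable.snd
  have hp : Computable fun r : ((ℕ × ℕ) × ℕ) × (ℕ × (ℕ × ℕ)) => r.2.2 :=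
    Computable.snd.comp Computable.snd
  have hp1 := Computable.fst.comp hp
  have he := Nat.Partrec.Code.primrec_evaln.to_comp.comp
    ((hs.pair ((Computable.ofNat Nat.Partrec.Code).comp hc)).pair
      (Primrec₂.natPair.to_comp.comp hp1 hk))
  refine Computable.option_getD (Computable.option_map he ?_) hp
  exact Computable.pair (Computable.succ.comp (hp1.comp Computable.fst)) Computable.snd

theorem computable_simState : Computable fun p : (ℕ × ℕ) × ℕ => simState p.1.1 p.1.2 p.2 := by
  have hh : Computable₂ fun (p : (ℕ × ℕ) × ℕ) (q : ℕ × (ℕ × ℕ)) =>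
      simStep p.1.1 p.1.2 q.1 q.2 := computable_simStep
  exact Computable.nat_rec Computable.snd (Computable.const (0, 0)) hh

theorem computable_simVal : Computable fun p : (ℕ × ℕ) × ℕ => simVal p.1.1 p.1.2 p.2 :=
  Primrec.nat_min.to_comp.comp (Computable.snd.comp computable_simState) Computable.snd

theorem exists_sim_index {v : ℕ → ℕ} (hv : Delta02Fun v) :
    ∃ c, ∀ k, ∃ t, ∀ s ≥ t, simVal c k s = v k := by
  obtain ⟨V, hV, hlim⟩ := hv
  obtain ⟨e, he⟩ := Nat.Partrec.Code.exists_code.1 (Partrec.nat_iff.1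
    (show Computable fun n : ℕ => V n.unpair.1 n.unpair.2 from
      hV.comp (Computable.fst.comp Computable.unpair) (Computable.snd.comp Computable.unpair)))
  refine ⟨Encodable.encode e, fun k => ?_⟩
  have hev : ∀ t w, w ∈ Nat.Partrec.Code.eval e (Nat.pair t k) ↔ w = V t k := by
    intro t w; simp [he]
  set S := simState (Encodable.encode e) k with hS
  have hstep : ∀ s, S (s + 1) = S s ∨ S (s + 1) = ((S s).1 + 1, V (S s).1 k) := by
    intro s
    rw [hS, simState_succ, simStep, Denumerable.ofNat_encode, ← hS]
    cases hx : Nat.Partrec.Code.evaln s e (Nat.pair (S s).1 k) with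
    | none => left; rfl
    | some w =>
      right
      rw [← (hev _ _).1 (Nat.Partrec.Code.evaln_sound hx)]
      rfl
  have hmono : Monotone fun s => (S s).1 := by
    refine monotone_nat_of_le_succ fun s => ?_
    rcases hstep s with h | h <;> simp [h]
  have hval : ∀ s, (S s).1 = 0 ∨ (S s).2 = V ((S s).1 - 1) k := by
    intro s
    induction s with
    | zero => left; rfl
    | succ s ih =>
      rcases hstep s with h | h
      · rwa [h]
      · right; simp [h]
  have hunb : ∀ t, ∃ s, t ≤ (S s).1 := by
    intro t
    induction t with
    | zero => exact ⟨0, Nat.zero_le _⟩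
    | succ t ih =>
      obtain ⟨s, hs⟩ := ih
      by_contra! hcon
      obtain ⟨u, hu⟩ := Nat.Partrec.Code.evaln_complete.1 ((hev t _).2 rfl)
      have h1 : (S (max s u)).1 = t :=
        le_antisymm (Nat.lt_succ_iff.1 (hcon _)) (hs.trans (hmono (le_max_left s u)))
      have h2 := Nat.Partrec.Code.evaln_mono (le_max_right s u) hu
      have h3 : S (max s u + 1) = (t + 1, V t k) := by
        rw [hS, simState_succ, simStep, Denumerable.ofNat_encode, ← hS, h1,
          Option.mem_def.1 h2]
        rfl
      have h4 := hcon (max s u + 1)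
      rw [h3] at h4
      exact lt_irrefl _ h4
  obtain ⟨t, ht⟩ := hlim k
  obtain ⟨u, hu⟩ := hunb (t + 1)
  refine ⟨max u (v k), fun s hs => ?_⟩
  have h1 : t + 1 ≤ (S s).1 := hu.trans (hmono (by omega))
  have h2 : (S s).2 = v k := by
    rcases hval s with h | h
    · omega
    · rw [h, ht _ (by omega)]
  show min (S s).2 s = v k
  rw [h2]; omega

theorem exists_enum_Delta02Fun :
    ∃ f : ℕ → ℕ → ℕ, (∀ j, Delta02Fun (f j)) ∧ ∀ v, Delta02Fun v → ∃ j, f j = v := by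
  classical
  let Q : ℕ → (ℕ → ℕ) → Prop := fun c v => Delta02Fun v ∧ ∀ k, ∃ t, ∀ s ≥ t, simVal c k s = v k
  refine ⟨fun j => if h : ∃ v, Q j v then h.choose else fun _ => 0, fun j => ?_, fun v hv => ?_⟩
  · by_cases h : ∃ v, Q j v
    · simp only [dif_pos h]; exact h.choose_spec.1
    · simp only [dif_neg h]; exact Delta02Fun.const 0
  · obtain ⟨c, hc⟩ := exists_sim_index hv
    have h : ∃ v, Q c v := ⟨v, hv, hc⟩
    refine ⟨c, ?_⟩
    simp only [dif_pos h]
    funext k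
    obtain ⟨t, ht⟩ := h.choose_spec.2 k
    obtain ⟨u, hu⟩ := hc k
    rw [← ht (max t u) (le_max_left _ _), hu (max t u) (le_max_right _ _)]

/-- The guess at stage `n` for the number described by the index `D = ⟨D', c + 1⟩`. -/
def guess (D n : ℕ) : ℕ := lastChange (simVal (D.unpair.2 - 1) D) n

theorem computable_guess : Computable₂ guess := by
  have h1 : Computable fun p : ℕ × ℕ => p.1.unpair.2 - 1 :=
    Computable.pred.comp (Computable.snd.comp (Computable.unpair.comp Computable.fst))
  have h2 : Computable fun p : ℕ × ℕ => ((p.1.unpair.2 - 1, p.1), p.2) :=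
    (h1.pair Computable.fst).pair Computable.snd
  have hF : Computable₂ fun D s : ℕ => simVal (D.unpair.2 - 1) D s :=
    (computable_simVal.comp h2 :)
  exact computable_lastChange hF

/-- Any number `D` can be extended to an index `D'` describing, for every `n` above it, a number
which bounds a given `Δ⁰₂` function at `D'`. -/
theorem exists_extension {v : ℕ → ℕ} (hv : Delta02Fun v) (D : ℕ) :
    ∃ D' a, D'.unpair.1 = D ∧ D < D' ∧ v D' ≤ a ∧ ∀ n ≥ a, guess D' n = a := by
  obtain ⟨c, hc⟩ := exists_sim_index hv
  have hD' : (Nat.pair D (c + 1)).unpair.2 - 1 = c := by simp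
  obtain ⟨a, ha⟩ := exists_lastChange (hc (Nat.pair D (c + 1)))
  refine ⟨Nat.pair D (c + 1), a, by simp, ?_, ?_, fun n hn => ?_⟩
  · unfold Nat.pair; split_ifs <;> nlinarith
  · rw [← (ha a le_rfl).2]; exact min_le_right _ _
  · rw [guess, hD']; exact (ha n hn).1

/-! ### Machines -/

theorem KOr_le (U : UniversalPrefixMachine) {A : Seq2} {p y : BinStr}
    (h : U.toPrefixOracleMachine.Computes A p y) : KOr U A y ≤ p.length :=
  Nat.sInf_le ⟨p, rfl, h⟩

theorem exists_shortest (U : UniversalPrefixMachine) (A : Seq2) (y : BinStr) :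
    ∃ p : BinStr, p.length = KOr U A y ∧ U.toPrefixOracleMachine.Computes A p y :=
  Nat.sInf_mem (s := {n | ∃ p : BinStr, p.length = n ∧ U.toPrefixOracleMachine.Computes A p y})
    (let ⟨p, hp⟩ := U.total A y; ⟨_, p, rfl, hp⟩)

theorem KOr_le_of_machine (U : UniversalPrefixMachine) (M : PrefixOracleMachine) :
    ∃ c, ∀ A p y, M.Computes A p y → KOr U A y ≤ p.length + c := by
  obtain ⟨c, hc⟩ := U.universal M
  refine ⟨c, fun A p y h => ?_⟩
  obtain ⟨q, hq, hl⟩ := hc A p y h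
  exact (KOr_le U hq).trans hl

theorem restrict_const (b : Bool) (n : ℕ) : restrict (fun _ => b) n = List.replicate n b := by
  simp [restrict, List.map_const']

theorem computable_replicate (b : Bool) : Computable fun n => List.replicate n b :=
  (computable_restrict (α := ℕ) (A := fun _ _ => b) (Computable.const b) Computable.id).of_eq
    fun n => restrict_const b n

/-- The self-delimiting unary code of a number. -/
def unary (D : ℕ) : BinStr := List.replicate D true ++ [false]

theorem computable_unary : Computable unary :=
  Computable.list_concat.comp (computable_replicate true) (Computable.const false)

theorem length_unary (D : ℕ) : (unary D).length = D + 1 := by simp [unary]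

theorem unary_append_inj {D E : ℕ} {p q : BinStr} (h : unary D ++ p <+: unary E ++ q) :
    D = E ∧ p <+: q := by
  induction D generalizing E with
  | zero =>
    cases E with
    | zero => simpa [unary] using h
    | succ E => simp [unary, List.replicate_succ] at h
  | succ D ih =>
    cases E with
    | zero => simp [unary, List.replicate_succ] at h
    | succ E =>
      have h' : unary D ++ p <+: unary E ++ q := by
        simpa [unary, List.replicate_succ] using h
      obtain ⟨rfl, h2⟩ := ih h'
      exact ⟨rfl, h2⟩

/-- On program `1^D 0 q` simulate `M` on `q`, and apply `out D` to the length of the result. -/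
def PrefixOracleMachine.postcompose (M : PrefixOracleMachine) (out : ℕ → ℕ → BinStr)
    (hout : Computable₂ out) : PrefixOracleMachine where
  axioms u := (M.axioms u.unpair.1).map fun a =>
    (a.1, unary u.unpair.2 ++ a.2.1, out u.unpair.2 a.2.2.length)
  axioms_computable := by
    refine Computable.option_map
      (M.axioms_computable.comp (Computable.fst.comp Computable.unpair)) ?_
    have hD : Computable fun r : ℕ × (BinStr × BinStr × BinStr) => r.1.unpair.2 :=
      Computable.snd.comp (Computable.unpair.comp Computable.fst)
    have hq : Computable fun r : ℕ × (BinStr × BinStr × BinStr) => r.2.2.1 :=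
      Computable.fst.comp (Computable.snd.comp Computable.snd)
    have hy : Computable fun r : ℕ × (BinStr × BinStr × BinStr) => r.2.2.2.length :=
      Computable.list_length.comp (Computable.snd.comp (Computable.snd.comp Computable.snd))
    exact (Computable.fst.comp Computable.snd).pair
      ((Computable.list_append.comp (computable_unary.comp hD) hq).pair (hout.comp hD hy))
  consistent := by
    intro s t τ₁ p₁ y₁ τ₂ p₂ y₂ h₁ h₂ hτ hp
    simp only [Option.map_eq_some_iff, Prod.exists, Prod.mk.injEq] at h₁ h₂
    obtain ⟨_, q₁, z₁, h₁, rfl, rfl, rfl⟩ := h₁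
    obtain ⟨_, q₂, z₂, h₂, rfl, rfl, rfl⟩ := h₂
    obtain ⟨hD, hq⟩ := unary_append_inj hp
    obtain ⟨rfl, rfl⟩ := M.consistent _ _ _ _ _ _ _ _ h₁ h₂ hτ hq
    rw [hD]
    exact ⟨rfl, rfl⟩

theorem exists_Kc_le (U : UniversalPrefixMachine) {out : ℕ → ℕ → BinStr} (hout : Computable₂ out) :
    ∃ c, ∀ D n, Kc U (out D n) ≤ KcNat U n + D + c := by
  obtain ⟨c, hc⟩ := KOr_le_of_machine U (U.toPrefixOracleMachine.postcompose out hout)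
  refine ⟨c + 1, fun D n => ?_⟩
  obtain ⟨q, hq, s, τ, hs, hτ⟩ := exists_shortest U zeroSeq (List.replicate n false)
  have h := hc zeroSeq (unary D ++ q) (out D n) ⟨Nat.pair s D, τ, by
    simp [PrefixOracleMachine.postcompose, hs], hτ⟩
  rw [List.length_append, length_unary, hq] at h
  show KOr U zeroSeq _ ≤ KOr U zeroSeq _ + D + (c + 1)
  omega

theorem count_eq_of_append_true {τ σ : BinStr} (h : τ ++ [true] <+: σ ++ [true])
    (hc : τ.count true = σ.count true) : τ = σ := by
  obtain ⟨r, hr⟩ := h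
  rcases List.eq_nil_or_concat r with rfl | ⟨r', b, rfl⟩
  · simpa using hr
  · exfalso
    rw [List.concat_eq_append, ← List.append_assoc] at hr
    have h1 := (List.append_inj' hr rfl).1
    rw [← h1] at hc
    simp at hc

theorem computable_count : Computable fun τ : BinStr => τ.count true := by
  have h1 : Computable₂ fun (τ : BinStr) (q : ℕ × ℕ) =>
      bif (τ[q.1]?).getD false then q.2 + 1 else q.2 := by
    have hi : Computable fun r : BinStr × (ℕ × ℕ) => r.2.1 := Computable.fst.comp Computable.snd
    have hk : Computable fun r : BinStr × (ℕ × ℕ) => r.2.2 := Computable.snd.comp Computable.snd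
    exact Computable.cond (Computable.option_getD
      (Computable.list_getElem?.comp Computable.fst hi) (Computable.const false))
      (Computable.succ.comp hk) hk
  refine (Computable.nat_rec Computable.list_length (Computable.const 0) h1).of_eq fun τ => ?_
  have key : ∀ n ≤ τ.length, (Nat.rec 0 (fun y IH =>
      bif (τ[y]?).getD false then IH + 1 else IH) n : ℕ) = (τ.take n).count true := by
    intro n hn
    induction n with
    | zero => simp
    | succ n ih =>
      have hlt : n < τ.length := by omega
      have ih' := ih (by omega)
      rw [List.take_add_one, List.count_append, ← ih', List.getElem?_eq_getElem hlt]
      cases h : τ[n] <;> simp [hlt, h]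
  simpa using key τ.length le_rfl

/-- The string coded by a number. -/
def strOf (u : ℕ) : BinStr := (Encodable.decode (α := BinStr) u).getD []

theorem strOf_encode (τ : BinStr) : strOf (Encodable.encode τ) = τ := by simp [strOf]

theorem computable_strOf : Computable strOf :=
  Computable.option_getD Computable.decode (Computable.const [])

/-- With an oracle extending `τ ++ [true]`, where `i` is the number of ones in `τ`, the program
`1^i 0` outputs `out i |τ|`. -/
def onesMachine (out : ℕ → ℕ → BinStr) (hout : Computable₂ out) : PrefixOracleMachine where
  axioms u := some (strOf u ++ [true],
    unary ((strOf u).count true),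
    out ((strOf u).count true) (strOf u).length)
  axioms_computable := by
    have h1 := computable_strOf
    have h2 := computable_count.comp h1
    exact Computable.option_some.comp ((Computable.list_concat.comp h1 (Computable.const true)).pair
      ((computable_unary.comp h2).pair (hout.comp h2 (Computable.list_length.comp h1))))
  consistent := by
    intro s t τ₁ p₁ y₁ τ₂ p₂ y₂ h₁ h₂ hτ hp
    simp only [Option.some.injEq, Prod.mk.injEq] at h₁ h₂
    obtain ⟨rfl, rfl, rfl⟩ := h₁
    obtain ⟨rfl, rfl, rfl⟩ := h₂
    have hc := (unary_append_inj (p := []) (q := []) (by simpa only [List.append_nil] using hp)).1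
    have : strOf s = strOf t := by
      rcases hτ with h | h
      · exact count_eq_of_append_true h hc
      · exact (count_eq_of_append_true h hc.symm).symm
    rw [this]
    exact ⟨rfl, rfl⟩

theorem exists_KOr_le (U : UniversalPrefixMachine) {out : ℕ → ℕ → BinStr}
    (hout : Computable₂ out) :
    ∃ c, ∀ (A : Seq2) (n : ℕ), A n = true →
      KOr U A (out ((restrict A n).count true) n) ≤ (restrict A n).count true + c := by
  obtain ⟨c, hc⟩ := KOr_le_of_machine U (onesMachine out hout)
  refine ⟨c + 1, fun A n hn => ?_⟩
  have h := hc A (unary ((restrict A n).count true)) (out ((restrict A n).count true) n)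
    ⟨Encodable.encode (restrict A n), restrict A n ++ [true], by
      simp [onesMachine, strOf_encode, length_restrict], n + 1, by rw [restrict_succ, hn]⟩
  rw [length_unary] at h
  omega

theorem count_eq_zero_iff (τ : BinStr) : τ.count true = 0 ↔ τ = restrict zeroSeq τ.length := by
  have h : restrict zeroSeq τ.length = List.replicate τ.length false := restrict_const false _
  rw [h, List.count_eq_zero, List.eq_replicate_iff]
  refine ⟨fun hn => ⟨rfl, fun b hb => ?_⟩, fun hn hb => by simpa using hn.2 true hb⟩
  cases b
  · rfl
  · exact absurd hb hn

/-! ### A fast growing function bounding outputs of short programs -/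

/-- A strict bound on the lengths of the outputs, found by stage `s`, of programs of length
`< 3 * i`. -/
def outBound (U : UniversalPrefixMachine) (i s : ℕ) : ℕ :=
  Nat.rec i (fun s r => ((U.axioms s).map fun a =>
    bif a.1.count true == 0 && decide (a.2.1.length < 3 * i) then
      max r (a.2.2.length + 1) else r).getD r) s

theorem outBound_succ (U : UniversalPrefixMachine) (i s : ℕ) :
    outBound U i (s + 1) = ((U.axioms s).map fun a =>
      bif a.1.count true == 0 && decide (a.2.1.length < 3 * i) then
        max (outBound U i s) (a.2.2.length + 1) else outBound U i s).getD (outBound U i s) := rfl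

theorem computable_outBound (U : UniversalPrefixMachine) : Computable₂ (outBound U) := by
  have h1 : Computable fun r : ((ℕ × ℕ) × (ℕ × ℕ)) × (BinStr × BinStr × BinStr) =>
      (bif r.2.1.count true == 0 && decide (r.2.2.1.length < 3 * r.1.1.1)
        then max r.1.2.2 (r.2.2.2.length + 1) else r.1.2.2 : ℕ) := by
    have hτ : Computable fun r : ((ℕ × ℕ) × (ℕ × ℕ)) × (BinStr × BinStr × BinStr) => r.2.1 :=
      Computable.fst.comp Computable.snd
    have hp : Computable fun r : ((ℕ × ℕ) × (ℕ × ℕ)) × (BinStr × BinStr × BinStr) =>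
        r.2.2.1.length :=
      Computable.list_length.comp (Computable.fst.comp (Computable.snd.comp Computable.snd))
    have hy : Computable fun r : ((ℕ × ℕ) × (ℕ × ℕ)) × (BinStr × BinStr × BinStr) =>
        r.2.2.2.length + 1 :=
      Computable.succ.comp (Computable.list_length.comp
        (Computable.snd.comp (Computable.snd.comp Computable.snd)))
    have hi : Computable fun r : ((ℕ × ℕ) × (ℕ × ℕ)) × (BinStr × BinStr × BinStr) =>
        3 * r.1.1.1 :=
      Primrec.nat_mul.to_comp.comp (Computable.const 3)
        (Computable.fst.comp (Computable.fst.comp Computable.fst))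
    have hr : Computable fun r : ((ℕ × ℕ) × (ℕ × ℕ)) × (BinStr × BinStr × BinStr) => r.1.2.2 :=
      Computable.snd.comp (Computable.snd.comp Computable.fst)
    have hc := Computable₂.natBeq (computable_count.comp hτ) (Computable.const 0)
    have hd := Primrec.nat_lt.decide.to_comp.comp hp hi
    exact Computable.cond (Primrec.and.to_comp.comp hc hd) (Primrec.nat_max.to_comp.comp hr hy) hr
  have h2 : Computable₂ fun (p : ℕ × ℕ) (q : ℕ × ℕ) => ((U.axioms q.1).map fun a =>
      (bif a.1.count true == 0 && decide (a.2.1.length < 3 * p.1) then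
        max q.2 (a.2.2.length + 1) else q.2 : ℕ)).getD q.2 :=
    Computable.option_getD (Computable.option_map
      (U.axioms_computable.comp (Computable.fst.comp Computable.snd)) h1)
      (Computable.snd.comp Computable.snd)
  exact Computable.nat_rec Computable.snd Computable.fst h2

theorem outBound_mono (U : UniversalPrefixMachine) (i : ℕ) : Monotone (outBound U i) := by
  refine monotone_nat_of_le_succ fun s => ?_
  rw [outBound_succ]
  cases U.axioms s with
  | none => exact le_rfl
  | some a =>
    simp only [Option.map_some, Option.getD_some]
    cases (a.1.count true == 0 && decide (a.2.1.length < 3 * i)) <;> simp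

theorem lt_outBound (U : UniversalPrefixMachine) {i : ℕ} {p y : BinStr}
    (h : U.toPrefixOracleMachine.Computes zeroSeq p y) (hp : p.length < 3 * i) :
    ∃ s, y.length < outBound U i s := by
  obtain ⟨s, τ, hs, n, rfl⟩ := h
  refine ⟨s + 1, ?_⟩
  rw [outBound_succ, hs]
  have h1 : ((restrict zeroSeq n).count true == 0) = true := by
    rw [beq_iff_eq]; exact (count_eq_zero_iff _).2 (by rw [length_restrict])
  have h2 : decide (p.length < 3 * i) = true := by simpa using hp
  simp only [Option.map_some, Option.getD_some, h1, h2]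
  simp

theorem PrefixOracleMachine.Computes.unique {M : PrefixOracleMachine} {A : Seq2} {p y z : BinStr}
    (hy : M.Computes A p y) (hz : M.Computes A p z) : y = z := by
  obtain ⟨s, τ, hs, n, rfl⟩ := hy
  obtain ⟨t, τ, ht, m, rfl⟩ := hz
  refine (M.consistent _ _ _ _ _ _ _ _ hs ht ?_ List.prefix_rfl).2
  have key : ∀ a b, a ≤ b → restrict A a <+: restrict A b := by
    intro a b hab
    induction b, hab using Nat.le_induction with
    | base => exact List.prefix_rfl
    | succ b _ ih => rw [restrict_succ]; exact ih.trans (List.prefix_append _ _)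
  exact (le_total n m).imp (key _ _) (key _ _)

theorem outBound_converges (U : UniversalPrefixMachine) (i : ℕ) :
    ∃ v, ∃ t, ∀ s ≥ t, outBound U i s = v := by
  classical
  have hfin : {p : BinStr | p.length < 3 * i}.Finite := List.finite_length_lt Bool (3 * i)
  have hb : ∃ B, ∀ p y, p.length < 3 * i → U.toPrefixOracleMachine.Computes zeroSeq p y →
      y.length + 1 ≤ B := by
    let len : BinStr → ℕ := fun p =>
      if h : ∃ y, U.toPrefixOracleMachine.Computes zeroSeq p y then h.choose.length + 1 else 0
    obtain ⟨B, hB⟩ := (hfin.image len).bddAbove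
    refine ⟨B, fun p y hp hy => ?_⟩
    have h : ∃ y, U.toPrefixOracleMachine.Computes zeroSeq p y := ⟨y, hy⟩
    have h1 : len p = y.length + 1 := by
      simp only [len, dif_pos h, h.choose_spec.unique hy]
    exact h1 ▸ hB ⟨p, hp, rfl⟩
  obtain ⟨B, hB⟩ := hb
  have hle : ∀ s, outBound U i s ≤ max i B := by
    intro s
    induction s with
    | zero => exact le_max_left _ _
    | succ s ih =>
      rw [outBound_succ]
      cases hs : U.axioms s with
      | none => exact ih
      | some a =>
        obtain ⟨τ, p, y⟩ := a
        simp only [Option.map_some, Option.getD_some]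
        cases hc : (τ.count true == 0 && decide (p.length < 3 * i)) with
        | false => simpa using ih
        | true =>
          rw [Bool.and_eq_true, beq_iff_eq, decide_eq_true_eq] at hc
          have := hB p y hc.2 ⟨s, τ, hs, τ.length, (count_eq_zero_iff τ).1 hc.1⟩
          simp only [cond_true]
          omega
  have hbdd : BddAbove (Set.range (outBound U i)) := ⟨max i B, by rintro _ ⟨s, rfl⟩; exact hle s⟩
  obtain ⟨t, ht⟩ := Nat.sSup_mem (Set.range_nonempty (outBound U i)) hbdd
  exact ⟨_, t, fun s hs => le_antisymm (le_csSup hbdd ⟨s, rfl⟩) (ht ▸ outBound_mono U i hs)⟩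
/-! ### Decoding initial segments of the constructed real -/

/-- The index obtained from `D` by forgetting the last `j` extensions. -/
def ancestor (D j : ℕ) : ℕ := Nat.rec D (fun _ E => E.unpair.1) j

theorem ancestor_succ (D j : ℕ) : ancestor D (j + 1) = (ancestor D j).unpair.1 := rfl

theorem computable_ancestor : Computable₂ ancestor :=
  Computable.nat_rec (h := fun (_ : ℕ × ℕ) (q : ℕ × ℕ) => q.2.unpair.1) Computable.snd Computable.fst
    (Computable.fst.comp (Computable.unpair.comp (Computable.snd.comp Computable.snd)))

/-- Whether `E` is a nonzero index whose guess at stage `n` is `x`. -/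
def isGuess (E n x : ℕ) : Bool := !(E == 0) && guess E n == x

theorem computable_isGuess : Computable fun p : ℕ × ℕ × ℕ => isGuess p.1 p.2.1 p.2.2 := by
  have hn : Computable fun p : ℕ × ℕ × ℕ => p.2.1 := Computable.fst.comp Computable.snd
  have hx : Computable fun p : ℕ × ℕ × ℕ => p.2.2 := Computable.snd.comp Computable.snd
  have h1 := Computable₂.natBeq (Computable.fst (α := ℕ) (β := ℕ × ℕ)) (Computable.const 0)
  have h2 := Computable₂.natBeq (computable_guess.comp Computable.fst hn) hx
  exact Primrec.and.to_comp.comp (Primrec.not.to_comp.comp h1) h2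

/-- Whether some `j < b` satisfies `P`. -/
def existsBelow (P : ℕ → Bool) (b : ℕ) : Bool := Nat.rec false (fun j r => r || P j) b

theorem existsBelow_iff (P : ℕ → Bool) (b : ℕ) :
    existsBelow P b = true ↔ ∃ j < b, P j = true := by
  induction b with
  | zero => simp [existsBelow]
  | succ b ih =>
    have h : existsBelow P (b + 1) = (existsBelow P b || P b) := rfl
    rw [h, Bool.or_eq_true, ih, Nat.exists_lt_succ_right]

theorem computable_existsBelow {α : Type*} [Primcodable α] {P : α → ℕ → Bool} {b : α → ℕ}
    (hP : Computable₂ P) (hb : Computable b) : Computable fun a => existsBelow (P a) (b a) := by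
  have hh : Computable₂ fun (a : α) (q : ℕ × Bool) => q.2 || P a q.1 :=
    Primrec.or.to_comp.comp (Computable.snd.comp Computable.snd)
      (hP.comp Computable.fst (Computable.fst.comp Computable.snd))
  exact Computable.nat_rec hb (Computable.const false) hh

/-- Whether `x` is the guess at stage `n` of `D` or one of its ancestors. -/
def guessed (D n x : ℕ) : Bool := existsBelow (fun j => isGuess (ancestor D j) n x) (D + 1)

theorem guessed_iff (D n x : ℕ) :
    guessed D n x = true ↔ ∃ j < D + 1, ancestor D j ≠ 0 ∧ guess (ancestor D j) n = x := by
  simp [guessed, existsBelow_iff, isGuess]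

theorem computable_guessed : Computable fun p : ℕ × ℕ × ℕ => guessed p.1 p.2.1 p.2.2 := by
  have hE : Computable fun r : (ℕ × ℕ × ℕ) × ℕ => (ancestor r.1.1 r.2, r.1.2) :=
    (computable_ancestor.comp (Computable.fst.comp Computable.fst) Computable.snd).pair
      (Computable.snd.comp Computable.fst)
  have hG : Computable₂ fun (p : ℕ × ℕ × ℕ) (j : ℕ) =>
      isGuess (ancestor p.1 j) p.2.1 p.2.2 :=
    (computable_isGuess.comp hE :)
  exact computable_existsBelow hG (Computable.succ.comp Computable.fst)

/-- The initial segment of length `n` guessed from the index `D`. -/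
def decodeSegment (D n : ℕ) : BinStr := restrict (fun x => guessed D n x) n

theorem computable_decodeSegment : Computable₂ decodeSegment := by
  have h : Computable fun r : (ℕ × ℕ) × ℕ => (r.1.1, r.1.2, r.2) :=
    (Computable.fst.comp Computable.fst).pair
      ((Computable.snd.comp Computable.fst).pair Computable.snd)
  have hA : Computable₂ fun (p : ℕ × ℕ) (x : ℕ) => guessed p.1 p.2 x :=
    (computable_guessed.comp h :)
  exact computable_restrict hA Computable.snd

/-- There are increasing sequences of numbers `a` and indices `D` such that `D i` describes
`a 1, …, a i` relative to any `n ≥ a i`, while `a` eventually dominates each `f j`, both at `i`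
and at `D i`. -/
theorem exists_sequences {f : ℕ → ℕ → ℕ} (hf : ∀ j, Delta02Fun (f j)) :
    ∃ D a : ℕ → ℕ, D 0 = 0 ∧ a 0 = 0 ∧ StrictMono D ∧ StrictMono a ∧
      (∀ i, (D (i + 1)).unpair.1 = D i) ∧ (∀ i, ∀ n ≥ a (i + 1), guess (D (i + 1)) n = a (i + 1)) ∧
      (∀ i, ∀ j ≤ i, f j i ≤ a (i + 1)) ∧ ∀ i, ∀ j ≤ i, f j (D (i + 1)) ≤ a (i + 1) := by
  have step : ∀ (i : ℕ) (S : ℕ × ℕ), ∃ S' : ℕ × ℕ, S'.1.unpair.1 = S.1 ∧ S.1 < S'.1 ∧ S.2 < S'.2 ∧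
      (∀ n ≥ S'.2, guess S'.1 n = S'.2) ∧ (∀ j ≤ i, f j i ≤ S'.2) ∧ ∀ j ≤ i, f j S'.1 ≤ S'.2 := by
    rintro i ⟨D, a⟩
    obtain ⟨D', a', h1, h2, h3, h4⟩ := exists_extension ((Delta02Fun.sum hf (i + 1)).add
      (Delta02Fun.const (a + 1 + ∑ j ∈ Finset.range (i + 1), f j i))) D
    have key : ∀ x, ∀ j ≤ i, f j x ≤ ∑ j ∈ Finset.range (i + 1), f j x := fun x j hj =>
      Finset.single_le_sum (f := fun j => f j x) (fun _ _ => Nat.zero_le _)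
        (Finset.mem_range.2 (by omega))
    refine ⟨(D', a'), h1, h2, by simp only; omega, h4, fun j hj => ?_, fun j hj => ?_⟩
    · have := key i j hj; simp only; omega
    · have := key D' j hj; simp only; omega
  choose next hnext using step
  let S : ℕ → ℕ × ℕ := fun i => Nat.rec (0, 0) next i
  have hS : ∀ i, S (i + 1) = next i (S i) := fun _ => rfl
  refine ⟨fun i => (S i).1, fun i => (S i).2, rfl, rfl,
    strictMono_nat_of_lt_succ fun i => (hnext i (S i)).2.1,
    strictMono_nat_of_lt_succ fun i => (hnext i (S i)).2.2.1,
    fun i => (hnext i (S i)).1, fun i => (hnext i (S i)).2.2.2.1,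
    fun i => (hnext i (S i)).2.2.2.2.1, fun i => (hnext i (S i)).2.2.2.2.2⟩

/-- The characteristic sequence of `{a 1, a 2, …}`. -/
noncomputable def seqOf (a : ℕ → ℕ) : Seq2 :=
  open Classical in fun x => decide (∃ i, a (i + 1) = x)

theorem seqOf_eq_true {a : ℕ → ℕ} {x : ℕ} : seqOf a x = true ↔ ∃ i, a (i + 1) = x := by
  simp [seqOf]

theorem count_restrict_seqOf {a : ℕ → ℕ} (ha : StrictMono a) (i : ℕ) :
    (restrict (seqOf a) (a (i + 1))).count true = i := by
  have h1 : ∀ n, (restrict (seqOf a) n).count true =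
      ((Finset.range n).filter fun x => seqOf a x = true).card := by
    intro n
    induction n with
    | zero => rfl
    | succ n ih =>
      rw [restrict_succ, List.count_append, ih, Finset.range_add_one, Finset.filter_insert]
      cases h : seqOf a n <;> simp
  have h2 : ((Finset.range (a (i + 1))).filter fun x => seqOf a x = true) =
      (Finset.range i).image fun j => a (j + 1) := by
    ext x
    simp only [Finset.mem_filter, Finset.mem_range, Finset.mem_image, seqOf_eq_true]
    constructor
    · rintro ⟨hx, j, rfl⟩
      exact ⟨j, by have := ha.lt_iff_lt.1 hx; omega, rfl⟩
    · rintro ⟨j, hj, rfl⟩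
      exact ⟨ha (by omega), j, rfl⟩
  rw [h1, h2, Finset.card_image_of_injective, Finset.card_range]
  intro x y hxy
  have := ha.injective hxy
  omega

theorem decodeSegment_eq {D a : ℕ → ℕ} (hD0 : D 0 = 0) (hD : StrictMono D) (ha : StrictMono a)
    (hpair : ∀ i, (D (i + 1)).unpair.1 = D i)
    (hguess : ∀ i, ∀ n ≥ a (i + 1), guess (D (i + 1)) n = a (i + 1))
    {i n : ℕ} (h1 : a i ≤ n) (h2 : n ≤ a (i + 1)) :
    decodeSegment (D i) n = restrict (seqOf a) n := by
  have hanc : ∀ j, ancestor (D i) j = D (i - j) := by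
    intro j
    induction j with
    | zero => rfl
    | succ j ih =>
      rw [ancestor_succ, ih]
      rcases Nat.lt_or_ge j i with h | h
      · obtain ⟨k, hk⟩ : ∃ k, i - j = k + 1 := ⟨i - j - 1, by omega⟩
        rw [hk, hpair]; congr 1; omega
      · rw [show i - j = 0 by omega, show i - (j + 1) = 0 by omega, hD0]; simp
  refine List.map_congr_left fun x hx => ?_
  have hx : x < n := List.mem_range.1 hx
  rw [Bool.eq_iff_iff, guessed_iff, seqOf_eq_true]
  constructor
  · rintro ⟨j, -, hj0, hj⟩
    rw [hanc] at hj0 hj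
    obtain ⟨k, hk⟩ : ∃ k, i - j = k + 1 :=
      Nat.exists_eq_succ_of_ne_zero fun h => hj0 (by rw [h, hD0])
    rw [hk, hguess k n ((ha.monotone (by omega)).trans h1)] at hj
    exact ⟨k, hj⟩
  · rintro ⟨k, rfl⟩
    have hk : k + 1 < i + 1 := ha.lt_iff_lt.1 (hx.trans_le h2)
    have hle : i ≤ D i := hD.le_apply
    refine ⟨i - (k + 1), by omega, ?_⟩
    rw [hanc, show i - (i - (k + 1)) = k + 1 by omega]
    exact ⟨by have : D 0 < D (k + 1) := hD (Nat.succ_pos k); omega, hguess k n hx.le⟩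

theorem pow_le_strNum (σ : BinStr) :
    2 ^ σ.length ≤ strNum σ + 1 ∧ strNum σ + 2 ≤ 2 * 2 ^ σ.length := by
  induction σ using List.reverseRecOn with
  | nil => simp [strNum]
  | append_singleton σ b ih =>
    have h : strNum (σ ++ [b]) = 2 * strNum σ + (if b then 2 else 1) := by simp [strNum]
    rw [h, List.length_append, List.length_singleton, pow_succ]
    cases b <;> simp <;> omega

theorem length_le_of_strNum_le {σ τ : BinStr} (h : strNum σ ≤ strNum τ) :
    σ.length ≤ τ.length := by
  by_contra! hlt
  have h1 := (pow_le_strNum σ).1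
  have h2 := (pow_le_strNum τ).2
  have h3 : 2 ^ (τ.length + 1) ≤ 2 ^ σ.length := Nat.pow_le_pow_right two_pos hlt
  rw [pow_succ] at h3
  omega

theorem ktDelta_seqOf (U : UniversalPrefixMachine) {f : ℕ → ℕ → ℕ} {D a : ℕ → ℕ}
    (hf : ∀ v, Delta02Fun v → ∃ j, f j = v)
    (hD0 : D 0 = 0) (ha0 : a 0 = 0) (hD : StrictMono D) (ha : StrictMono a)
    (hpair : ∀ i, (D (i + 1)).unpair.1 = D i)
    (hguess : ∀ i, ∀ n ≥ a (i + 1), guess (D (i + 1)) n = a (i + 1))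
    (hdom : ∀ i, ∀ j ≤ i, f j (D (i + 1)) ≤ a (i + 1)) : KTDelta U (seqOf a) := by
  intro g hg hord
  obtain ⟨v, hv, hv'⟩ := hg.exists_inverse fun k => (hord.2 k).imp fun _ h => h.le
  obtain ⟨e, rfl⟩ := hf v hv
  obtain ⟨c, hc⟩ := exists_Kc_le U computable_decodeSegment
  refine ⟨D e + c, fun n => ?_⟩
  obtain ⟨i, h1, h2⟩ : ∃ i, a i ≤ n ∧ n ≤ a (i + 1) := by
    have hex : ∃ k, n ≤ a (k + 1) := ⟨n, (Nat.le_succ n).trans ha.le_apply⟩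
    classical
    refine ⟨Nat.find hex, ?_, Nat.find_spec hex⟩
    rcases hk : Nat.find hex with _ | k
    · omega
    · have := Nat.find_min hex (m := k) (by omega)
      omega
  have h3 := hc (D i) n
  rw [decodeSegment_eq hD0 hD ha hpair hguess h1 h2] at h3
  suffices D i ≤ g n + D e by omega
  rcases Nat.lt_or_ge e i with h | h
  · obtain ⟨k, rfl⟩ : ∃ k, i = k + 1 := ⟨i - 1, by omega⟩
    have h4 := (hv' (D (k + 1))).1
    have h5 := hord.1 ((hdom k e (by omega)).trans h1)
    omega
  · have := hD.monotone h
    omega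

theorem not_lkDelta_seqOf (U : UniversalPrefixMachine) {f : ℕ → ℕ → ℕ} {a : ℕ → ℕ}
    (hf : ∀ v, Delta02Fun v → ∃ j, f j = v) (ha : StrictMono a)
    (hdom : ∀ i, ∀ j ≤ i, f j i ≤ a (i + 1)) : ¬ LKDelta U (seqOf a) := by
  intro hLK
  choose m hm using outBound_converges U
  have hcomp : Computable₂ fun s i => outBound U i s :=
    (computable_outBound U).comp Computable.snd Computable.fst
  have hmle : ∀ i, i ≤ m i := fun i => by
    obtain ⟨t, ht⟩ := hm i
    rw [← ht t le_rfl]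
    exact outBound_mono U i (Nat.zero_le t)
  obtain ⟨G, ⟨H, hH, hHlim⟩, hG⟩ :=
    Delta02Fun.exists_inverse (h := m) ⟨_, hcomp, hm⟩ fun k => ⟨k, hmle k⟩
  have hGm : ∀ i, G (m i) ≤ i := fun i => by
    by_contra! h
    exact lt_irrefl _ ((hG (m i)).2 i h)
  obtain ⟨d, hd, hd'⟩ := exists_modulus hcomp hm
  obtain ⟨e, rfl⟩ := hf d hd
  obtain ⟨c, hc⟩ := hLK (fun σ => G σ.length)
    ⟨fun s σ => H s σ.length, hH.comp Computable.fst (Computable.list_length.comp Computable.snd),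
      fun σ => hHlim _⟩
    ⟨fun σ τ h => by
      have hl := length_le_of_strNum_le h
      by_contra! hlt
      have h1 := (hG σ.length).2 _ hlt
      have h2 := (hG τ.length).1
      omega,
    fun b => ⟨List.replicate (∑ j ∈ Finset.range (b + 1), m j + 1) false, by
      simp only [List.length_replicate]
      by_contra! hle
      have h1 := (hG (∑ j ∈ Finset.range (b + 1), m j + 1)).1
      have h2 := Finset.single_le_sum (f := m) (fun _ _ => Nat.zero_le _)
        (Finset.mem_range.2 (show G (∑ j ∈ Finset.range (b + 1), m j + 1) < b + 1 by omega))
      omega⟩⟩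
  have hout : Computable₂ fun i s => List.replicate (outBound U i s) false :=
    (computable_replicate false).comp (computable_outBound U)
  obtain ⟨c', hc'⟩ := exists_KOr_le U hout
  set i := e + c + c' + 1 with hi
  have h1 := hc' (seqOf a) (a (i + 1)) (seqOf_eq_true.2 ⟨i, rfl⟩)
  rw [count_restrict_seqOf ha, hd' i _ (hdom i e (by omega))] at h1
  have h2 := hc (List.replicate (m i) false)
  have h3 := hGm i
  simp only [List.length_replicate] at h2
  have h4 : 3 * i ≤ Kc U (List.replicate (m i) false) := by
    obtain ⟨p, hp, hcp⟩ := exists_shortest U zeroSeq (List.replicate (m i) false)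
    by_contra! hlt
    obtain ⟨s, hs⟩ := lt_outBound U hcp (hp.trans_lt hlt)
    obtain ⟨t, ht⟩ := hm i
    have h5 := outBound_mono U i (le_max_left s t)
    rw [ht _ (le_max_right s t)] at h5
    rw [List.length_replicate] at hs
    omega
  omega

/-- KT(Δ⁰₂) ⊄ LK(Δ⁰₂). -/
theorem stmt9 (U : UniversalPrefixMachine) :
    ∃ A : Seq2, KTDelta U A ∧ ¬ LKDelta U A := by
  obtain ⟨f, hf, hf'⟩ := exists_enum_Delta02Fun
  obtain ⟨D, a, hD0, ha0, hD, ha, hpair, hguess, hdom, hdom'⟩ := exists_sequences hf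
  exact ⟨seqOf a, ktDelta_seqOf U hf' hD0 ha0 hD ha hpair hguess hdom',
    not_lkDelta_seqOf U hf' ha hdom⟩
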